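/- For every ε > 0 there exists N such that for all even n ≥ N, the binary logarithm 𝒩(n) of the number of bent functions in n variables satisfies 𝒩(n) ≤ (11/32 + ε)·2ⁿ. -/

import Mathlib

/-- Inner product on 𝔽₂ⁿ. -/
def ip {n : ℕ} (x y : Fin n → ZMod 2) : ZMod 2 := ∑ i, x i * y i

/-- Walsh–Hadamard transform of a Boolean function. -/
def walsh {n : ℕ} (f : (Fin n → ZMod 2) → ZMod 2) (y : Fin n → ZMod 2) : ℤ :=
  ∑ x, (-1 : ℤ) ^ (f x + ip x y).val

/-- `f` is bent: all Walsh coefficients are `±2^(n/2)`. -/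
def IsBent {n : ℕ} (f : (Fin n → ZMod 2) → ZMod 2) : Prop :=
  ∀ y, walsh f y = 2 ^ (n / 2) ∨ walsh f y = -2 ^ (n / 2)

/-- `𝒩(n)`: the binary logarithm of the number of bent functions in `n` variables. -/
noncomputable def logNumBent (n : ℕ) : ℝ :=
  Real.logb 2 (Nat.card {f : (Fin n → ZMod 2) → ZMod 2 // IsBent f})

/-! ### Fourier transform on the Boolean cube -/

/-- The character `a ↦ (-1)^a` of `ZMod 2`. -/
def sgn (a : ZMod 2) : ℤ := (-1) ^ a.val

@[simp] theorem sgn_zero : sgn 0 = 1 := rfl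

@[simp] theorem sgn_one : sgn 1 = -1 := rfl

theorem sgn_add (a b : ZMod 2) : sgn (a + b) = sgn a * sgn b := by
  revert a b; decide

theorem sgn_injective : Function.Injective sgn := by decide

theorem zmod_two_add_self (a : ZMod 2) : a + a = 0 := CharTwo.add_self_eq_zero a

/-- Restriction of a function on a cube to the half where the first coordinate is `b`. -/
def slice {m : ℕ} {M : Type*} (b : ZMod 2) (F : (Fin (m + 1) → ZMod 2) → M) :
    (Fin m → ZMod 2) → M :=
  fun x => F (Fin.cons b x)

theorem sum_cube_succ {m : ℕ} {M : Type*} [AddCommMonoid M] (F : (Fin (m + 1) → ZMod 2) → M) :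
    ∑ x, F x = ∑ x, slice 0 F x + ∑ x, slice 1 F x := by
  rw [← (Fin.consEquiv fun _ => ZMod 2).sum_comp, Fintype.sum_prod_type]
  exact Fin.sum_univ_two _

theorem cube_ext {m : ℕ} {M : Type*} {F G : (Fin (m + 1) → ZMod 2) → M}
    (h : ∀ b, slice b F = slice b G) : F = G := by
  funext x
  rw [← Fin.cons_self_tail x]
  exact congrFun (h (x 0)) (Fin.tail x)

theorem ip_cons {m : ℕ} (a b : ZMod 2) (x y : Fin m → ZMod 2) :
    ip (Fin.cons a x : Fin (m + 1) → ZMod 2) (Fin.cons b y) = a * b + ip x y := by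
  simp [ip, Fin.sum_univ_succ]

/-- The Fourier transform of an integer-valued function on the cube. -/
def cubeFourier {m : ℕ} (F : (Fin m → ZMod 2) → ℤ) (y : Fin m → ZMod 2) : ℤ :=
  ∑ x, F x * sgn (ip x y)

theorem walsh_eq_cubeFourier {m : ℕ} (f : (Fin m → ZMod 2) → ZMod 2) :
    walsh f = cubeFourier fun x => sgn (f x) := by
  funext y
  simp only [walsh, cubeFourier, ← sgn_add]
  rfl

theorem cubeFourier_cons {m : ℕ} (F : (Fin (m + 1) → ZMod 2) → ℤ) (b : ZMod 2)
    (y : Fin m → ZMod 2) :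
    cubeFourier F (Fin.cons b y) =
      cubeFourier (slice 0 F) y + sgn b * cubeFourier (slice 1 F) y := by
  simp only [cubeFourier, sum_cube_succ, slice, ip_cons, zero_mul, zero_add, one_mul, sgn_add,
    Finset.mul_sum]
  congr 1
  exact Finset.sum_congr rfl fun x _ => by ring

theorem cubeFourier_add {m : ℕ} (F G : (Fin m → ZMod 2) → ℤ) :
    cubeFourier (F + G) = cubeFourier F + cubeFourier G := by
  funext y
  simp [cubeFourier, add_mul, Finset.sum_add_distrib]

theorem cubeFourier_sub {m : ℕ} (F G : (Fin m → ZMod 2) → ℤ) :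
    cubeFourier (F - G) = cubeFourier F - cubeFourier G := by
  funext y
  simp [cubeFourier, sub_mul, Finset.sum_sub_distrib]

theorem cubeFourier_const_mul {m : ℕ} (a : ℤ) (F : (Fin m → ZMod 2) → ℤ) (y : Fin m → ZMod 2) :
    cubeFourier (fun x => a * F x) y = a * cubeFourier F y := by
  simp only [cubeFourier, Finset.mul_sum, mul_assoc]

theorem cubeFourier_cubeFourier : ∀ {m : ℕ} (F : (Fin m → ZMod 2) → ℤ) (x : Fin m → ZMod 2),
    cubeFourier (cubeFourier F) x = 2 ^ m * F x
  | 0, F, x => by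
    rw [Subsingleton.elim x default]
    simp only [cubeFourier, ip, Finset.univ_unique, Finset.sum_singleton, Finset.univ_eq_empty,
      Finset.sum_empty, sgn_zero, mul_one, pow_zero, one_mul]
    exact congrArg F (Subsingleton.elim _ _)
  | m + 1, F, x => by
    have h0 : slice 0 (cubeFourier F) = cubeFourier (slice 0 F) + cubeFourier (slice 1 F) := by
      funext y; simp [slice, cubeFourier_cons]
    have h1 : slice 1 (cubeFourier F) = cubeFourier (slice 0 F) - cubeFourier (slice 1 F) := by
      funext y
      simp [slice, cubeFourier_cons]
      ring
    have key (b : ZMod 2) (z : Fin m → ZMod 2) :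
        cubeFourier (cubeFourier F) (Fin.cons b z) = 2 ^ (m + 1) * F (Fin.cons b z) := by
      rw [cubeFourier_cons, h0, h1, cubeFourier_add, cubeFourier_sub, Pi.add_apply, Pi.sub_apply,
        cubeFourier_cubeFourier, cubeFourier_cubeFourier]
      rcases (by decide : ∀ b : ZMod 2, b = 0 ∨ b = 1) b with rfl | rfl <;>
        simp only [slice, sgn_zero, sgn_one] <;> ring
    rw [← Fin.cons_self_tail x]
    exact key _ _

/-! ### Functions of low algebraic degree -/

/-- `LowDeg m r g` says that `g` is a polynomial of degree less than `r` in `m` variables. -/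
def LowDeg : ∀ m : ℕ, ℕ → ((Fin m → ZMod 2) → ZMod 2) → Prop
  | 0, r, g => r = 0 → g = 0
  | m + 1, r, g => LowDeg m r (slice 0 g) ∧ LowDeg m (r - 1) (slice 0 g + slice 1 g)

theorem LowDeg.add : ∀ {m r : ℕ} {g h : (Fin m → ZMod 2) → ZMod 2},
    LowDeg m r g → LowDeg m r h → LowDeg m r (g + h)
  | 0, r, g, h, hg, hh => fun hr => by rw [hg hr, hh hr, add_zero]
  | m + 1, r, g, h, hg, hh => by
    refine ⟨hg.1.add hh.1, ?_⟩
    have := hg.2.add hh.2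
    rwa [add_add_add_comm] at this

theorem LowDeg.mono : ∀ {m r r' : ℕ} {g : (Fin m → ZMod 2) → ZMod 2},
    r ≤ r' → LowDeg m r g → LowDeg m r' g
  | 0, r, r', g, hr, hg => fun h => hg (by omega)
  | m + 1, r, r', g, hr, hg => ⟨hg.1.mono hr, hg.2.mono (by omega)⟩

theorem LowDeg.slice {m r : ℕ} {g : (Fin (m + 1) → ZMod 2) → ZMod 2} (hg : LowDeg (m + 1) r g)
    (b : ZMod 2) : LowDeg m r (slice b g) := by
  have h1 : _root_.slice 1 g = _root_.slice 0 g + (_root_.slice 0 g + _root_.slice 1 g) := by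
    funext x
    simp [← add_assoc, zmod_two_add_self]
  fin_cases b
  · exact hg.1
  · change LowDeg m r (_root_.slice 1 g)
    rw [h1]
    exact hg.1.add (hg.2.mono (Nat.sub_le _ _))

theorem lowDeg_of_dvd_cubeFourier : ∀ {m r a : ℕ} {c : ℤ} {F G : (Fin m → ZMod 2) → ℤ},
    (∀ x, F x = c - 2 * G x) → (∀ y, (2 : ℤ) ^ a ∣ cubeFourier F y) → m + 2 ≤ a + r →
      (4 : ℤ) ∣ c * 2 ^ r → LowDeg m r fun x => (G x : ZMod 2)
  | 0, r, a, c, F, G, hF, hd, hm, hc => by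
    rintro rfl
    funext x
    rw [Subsingleton.elim x default]
    have ha : (2 : ℤ) ^ a ∣ F default := by
      have h := hd default
      simp only [cubeFourier, ip, Finset.univ_unique, Finset.sum_singleton, Finset.univ_eq_empty,
        Finset.sum_empty, sgn_zero, mul_one] at h
      convert h
    have h4 : (4 : ℤ) ∣ F default := (pow_dvd_pow (2 : ℤ) (show 2 ≤ a by omega)).trans ha
    have := hF default
    exact (ZMod.intCast_zmod_eq_zero_iff_dvd _ 2).2 (by omega)
  | m + 1, r, a, c, F, G, hF, hd, hm, hc => by
    constructor
    · refine lowDeg_of_dvd_cubeFourier (a := a - 1) (c := c) (F := slice 0 F) (G := slice 0 G)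
        (fun x => hF _) (fun y => ?_) (by omega) hc
      rcases a with _ | a
      · simp
      have h0 := hd (Fin.cons 0 y)
      have h1 := hd (Fin.cons 1 y)
      rw [cubeFourier_cons] at h0 h1
      have := dvd_add h0 h1
      simp only [sgn_zero, sgn_one] at this
      rw [show cubeFourier (slice 0 F) y + 1 * cubeFourier (slice 1 F) y +
        (cubeFourier (slice 0 F) y + -1 * cubeFourier (slice 1 F) y) =
          2 * cubeFourier (slice 0 F) y by ring, pow_succ'] at this
      exact (mul_dvd_mul_iff_left two_ne_zero).1 this
    · have := lowDeg_of_dvd_cubeFourier (r := r - 1) (a := a) (c := 2 * c)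
        (F := slice 0 F + slice 1 F) (G := slice 0 G + slice 1 G)
        (fun x => by simp only [Pi.add_apply, slice, hF]; ring) (fun y => ?_) (by omega) ?_
      · convert this using 1
        funext x
        simp [slice]
      · have := hd (Fin.cons 0 y)
        rwa [cubeFourier_cons, sgn_zero, one_mul, ← Pi.add_apply, ← cubeFourier_add] at this
      · rcases r with _ | r
        · simpa using (Dvd.dvd.mul_left (by simpa using hc) 2)
        · rw [pow_succ] at hc
          convert hc using 1
          simp
          ring

theorem lowDeg_of_dvd_walsh {m r a : ℕ} {g : (Fin m → ZMod 2) → ZMod 2}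
    (hd : ∀ y, (2 : ℤ) ^ a ∣ walsh g y) (hm : m + 2 ≤ a + r) (hr : 2 ≤ r) : LowDeg m r g := by
  have hF : ∀ x, (fun x => sgn (g x)) x = 1 - 2 * ((g x).val : ℤ) := by
    intro x
    exact (by decide : ∀ b : ZMod 2, sgn b = 1 - 2 * (b.val : ℤ)) (g x)
  have := lowDeg_of_dvd_cubeFourier hF (fun y => by rw [← walsh_eq_cubeFourier]; exact hd y) hm
    (by rw [one_mul]; exact pow_dvd_pow (2 : ℤ) hr)
  simpa using this

/-- The number of monomials of degree less than `r` in `m` variables. -/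
def numMonomials (m r : ℕ) : ℕ := ∑ i ∈ Finset.range r, m.choose i

theorem numMonomials_succ (m r : ℕ) :
    numMonomials (m + 1) r = numMonomials m r + numMonomials m (r - 1) := by
  rcases r with _ | r
  · simp [numMonomials]
  · simp only [numMonomials, Finset.sum_range_succ' _ r, Nat.choose_succ_succ,
      Finset.sum_add_distrib, Nat.add_sub_cancel, Nat.choose_zero_right]
    ring

theorem numMonomials_mono (m : ℕ) : Monotone (numMonomials m) := fun _ _ h =>
  Finset.sum_le_sum_of_subset (Finset.range_mono h)

open Classical in
/-- Functions of degree less than `r` supported in `U`. -/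
noncomputable def lowDegOn (m r : ℕ) (U : Finset (Fin m → ZMod 2)) :
    Finset ((Fin m → ZMod 2) → ZMod 2) :=
  {g | LowDeg m r g ∧ ∀ x ∉ U, g x = 0}

theorem mem_lowDegOn {m r : ℕ} {U : Finset (Fin m → ZMod 2)} {g : (Fin m → ZMod 2) → ZMod 2} :
    g ∈ lowDegOn m r U ↔ LowDeg m r g ∧ ∀ x ∉ U, g x = 0 := by
  classical
  simp [lowDegOn]

theorem Finset.card_le_card_of_add_mem {G : Type*} [Add G] [IsRightCancelAdd G] {S T : Finset G}
    (h : ∀ a ∈ S, ∀ b ∈ S, a + b ∈ T) : S.card ≤ T.card := by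
  rcases S.eq_empty_or_nonempty with rfl | ⟨b, hb⟩
  · simp
  · exact Finset.card_le_card_of_injOn (· + b) (fun a ha => h a ha b hb)
      fun _ _ _ _ h => add_right_cancel h

/-- The part of `U` in the half of the cube where the first coordinate is `b`. -/
def sliceSet {m : ℕ} (b : ZMod 2) (U : Finset (Fin (m + 1) → ZMod 2)) :
    Finset (Fin m → ZMod 2) :=
  {x | Fin.cons b x ∈ U}

theorem card_sliceSet_add {m : ℕ} (U : Finset (Fin (m + 1) → ZMod 2)) :
    (sliceSet 0 U).card + (sliceSet 1 U).card = U.card := by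
  simp only [sliceSet, Finset.card_filter]
  have := sum_cube_succ fun x => if x ∈ U then 1 else 0
  simp only [slice] at this
  rw [← this]
  simp

theorem card_lowDegOn_succ_le (m r : ℕ) (U : Finset (Fin (m + 1) → ZMod 2)) :
    (lowDegOn (m + 1) r U).card ≤ (lowDegOn m r (sliceSet 0 U ∩ sliceSet 1 U)).card *
      (lowDegOn m (r - 1) (sliceSet 0 U ∪ sliceSet 1 U)).card := by
  classical
  refine Finset.card_le_mul_card_image_of_maps_to
    (f := fun g => slice 0 g + slice 1 g) (fun g hg => ?_) _ fun d _ => ?_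
  · rw [mem_lowDegOn] at hg ⊢
    refine ⟨hg.1.2, fun x hx => ?_⟩
    simp only [Finset.mem_union, sliceSet, Finset.mem_filter, Finset.mem_univ, true_and,
      not_or] at hx
    simp [slice, hg.2 _ hx.1, hg.2 _ hx.2]
  · have hinj : Set.InjOn (slice 0)
        ((lowDegOn (m + 1) r U).filter fun g => slice 0 g + slice 1 g = d :
          Set ((Fin (m + 1) → ZMod 2) → ZMod 2)) := by
      intro g hg g' hg' h
      simp only [Finset.coe_filter, Set.mem_ofPred_eq] at hg hg'
      have h1 : slice 1 g = slice 1 g' := by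
        have := hg.2.trans hg'.2.symm
        rw [h] at this
        exact add_left_cancel this
      refine cube_ext fun b => ?_
      fin_cases b
      exacts [h, h1]
    rw [← Finset.card_image_of_injOn hinj]
    refine Finset.card_le_card_of_add_mem ?_
    simp only [Finset.mem_image, Finset.mem_filter, mem_lowDegOn, forall_exists_index, and_imp]
    rintro _ g hg hgU hgd rfl _ g' hg' hgU' hgd' rfl
    refine ⟨hg.1.add hg'.1, fun x hx => ?_⟩
    simp only [Finset.mem_inter, sliceSet, Finset.mem_filter, Finset.mem_univ, true_and,
      not_and_or] at hx
    rcases hx with hx | hx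
    · simp [slice, hgU _ hx, hgU' _ hx]
    · have h0 := congrFun (hgd.trans hgd'.symm) x
      simp only [slice, Pi.add_apply, hgU _ hx, hgU' _ hx, add_zero] at h0
      simp [slice, h0, zmod_two_add_self]

theorem card_lowDegOn_pow_le : ∀ (m r : ℕ) (U : Finset (Fin m → ZMod 2)),
    (lowDegOn m r U).card ^ 2 ^ m ≤ 2 ^ (numMonomials m r * U.card)
  | 0, r, U => by
    by_cases h : r = 0 ∨ U = ∅
    · have : lowDegOn 0 r U ⊆ {0} := by
        intro g hg
        rw [mem_lowDegOn] at hg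
        rw [Finset.mem_singleton]
        rcases h with h | h
        · exact hg.1 h
        · funext x
          exact hg.2 x (by simp [h])
      have := Finset.card_le_card this
      simp only [Finset.card_singleton] at this
      simpa using this.trans Nat.one_le_two_pow
    · push Not at h
      obtain ⟨r, rfl⟩ := Nat.exists_eq_succ_of_ne_zero h.1
      have hU : 1 ≤ U.card := h.2.card_pos
      have hr : 1 ≤ numMonomials 0 (r + 1) := by
        simp [numMonomials, Finset.sum_range_succ']
      calc (lowDegOn 0 (r + 1) U).card ^ 2 ^ 0
          = (lowDegOn 0 (r + 1) U).card := by simp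
        _ ≤ Fintype.card ((Fin 0 → ZMod 2) → ZMod 2) := Finset.card_le_univ _
        _ = 2 ^ 1 := by simp [ZMod.card]
        _ ≤ _ := Nat.pow_le_pow_right (by norm_num) (Nat.mul_le_mul hr hU)
  | m + 1, r, U => by
    set A := sliceSet 0 U ∩ sliceSet 1 U
    set B := sliceSet 0 U ∪ sliceSet 1 U
    have hAB : A.card + B.card = U.card := by
      rw [Finset.card_inter_add_card_union, card_sliceSet_add]
    have hle : A.card ≤ B.card :=
      Finset.card_le_card (Finset.inter_subset_left.trans Finset.subset_union_left)
    have hD := numMonomials_mono m (Nat.sub_le r 1)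
    calc (lowDegOn (m + 1) r U).card ^ 2 ^ (m + 1)
        ≤ ((lowDegOn m r A).card * (lowDegOn m (r - 1) B).card) ^ 2 ^ (m + 1) :=
          Nat.pow_le_pow_left (card_lowDegOn_succ_le m r U) _
      _ = ((lowDegOn m r A).card ^ 2 ^ m * (lowDegOn m (r - 1) B).card ^ 2 ^ m) ^ 2 := by
          rw [← mul_pow, ← pow_mul, pow_succ]
      _ ≤ (2 ^ (numMonomials m r * A.card) * 2 ^ (numMonomials m (r - 1) * B.card)) ^ 2 := by
          refine Nat.pow_le_pow_left (Nat.mul_le_mul ?_ ?_) _ <;> exact card_lowDegOn_pow_le _ _ _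
      _ = 2 ^ (2 * (numMonomials m r * A.card + numMonomials m (r - 1) * B.card)) := by
          rw [← pow_add, ← pow_mul, mul_comm]
      _ ≤ _ := by
          apply Nat.pow_le_pow_right (by norm_num)
          rw [numMonomials_succ, ← hAB]
          nlinarith [mul_le_mul hD hle]

/-! ### The finite pattern problem

A pattern is a subset of `Fin 8`, encoded as a natural number below `256`. -/

/-- Number of ones of an 8-bit pattern. -/
def popcount (x : ℕ) : ℕ :=
  x % 2 + x / 2 % 2 + x / 4 % 2 + x / 8 % 2 + x / 16 % 2 + x / 32 % 2 + x / 64 % 2 + x / 128 % 2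

theorem popcount_eq_sum_testBit (x : ℕ) :
    popcount x = ∑ e ∈ Finset.range 8, (x.testBit e).toNat := by
  simp [popcount, Finset.sum_range_succ, Nat.toNat_testBit]

/-- The linear function `e ↦ ⟨c, e⟩` on `𝔽₂³`, as an 8-bit pattern. -/
def character (c : ℕ) : ℕ :=
  (if c.testBit 0 then 170 else 0) ^^^ (if c.testBit 1 then 204 else 0) ^^^
    (if c.testBit 2 then 240 else 0)

/-- The linear functionals of a pattern that are revealed one after the other. -/
def query : ℕ → ℕ → Bool
  | 0, s => s.testBit 1 ^^ s.testBit 2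
  | 1, s => s.testBit 0
  | _, s => s.testBit 1 ^^ s.testBit 4

/-- The Walsh coefficients of a pattern at `0, 1, 2, 4`, packed into one number. -/
def spectrumKey (s : ℕ) : ℕ :=
  (popcount (s ^^^ character 0) + 4 * popcount (s ^^^ character 1) +
    24 * popcount (s ^^^ character 2) + 38 * popcount (s ^^^ character 4)) % 224

/-- The information on a pattern available before `query i` is revealed. -/
def knowledge : ℕ → ℕ → ℕ
  | 0, s => spectrumKey s
  | i + 1, s => 2 * knowledge i s + (query i s).toNat

/-- The values of `knowledge i` that do not determine `query i`. -/
def ambiguityTable : ℕ → ℕ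
  | 0 => 8850363944172215584808509153335214055348423917942548104302290862080
  | 1 =>
    2839246936089269097753664624309139000390480457616744445845669697096507160044871326497959713639373463239408709916944829996854107177472
  | _ =>
    32244539261395167977575066142582164919183970846252355694140283105579091449859599216757348187166500828529005537546102350744965580547914081569892477173717783766842941993264929370759878672418571012610799523666550030955359034018765406050577477796463235096492094894637056

/-- The value of `query i` as a function of `knowledge i` where it is determined. -/
def predictionTable : ℕ → ℕ
  | 0 => 1072875449440742521744322230306066034098896551959811966561539760500
  | 1 =>
    92274794004137707961558560016210664694956358994206655349430777186592326467621995767643285085036614751260100785615690478624533450334208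
  | _ =>
    12099575143599366054857384371912417956454481688527028183201904100075717056788960299570236750496319958450796807242360455980095406978130834335681037842154668680141374938958841464819049610901347622771229049041614868441259677974343177773000420878317551891710120611282944

/-- `query i s` is not determined by `knowledge i s`. -/
def ambiguous (i s : ℕ) : Bool := (ambiguityTable i).testBit (knowledge i s)

theorem sum_ambiguous_le : ∀ s < 256, ∑ t ∈ Finset.range 8, ∑ i ∈ Finset.range 3,
    (ambiguous i (s ^^^ character t)).toNat ≤ 12 := by
  decide +kernel

theorem ambiguous_or_query_eq : ∀ s < 256, ∀ i < 3,
    ambiguous i s ∨ query i s = (predictionTable i).testBit (knowledge i s) := by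
  decide +kernel

theorem nodup_knowledge_three : ((List.range 256).map (knowledge 3)).Nodup := by
  decide +kernel

theorem injOn_knowledge_three : Set.InjOn (knowledge 3) (Set.Iio 256) := fun _ hs _ hs' h =>
  List.inj_on_of_nodup_map nodup_knowledge_three (List.mem_range.2 hs) (List.mem_range.2 hs') h

theorem character_lt : ∀ c < 8, character c < 256 := by decide

theorem character_xor : ∀ i < 4, ∀ t < 8,
    character ((2 ^ i / 2) ^^^ t) = character t ^^^ character (2 ^ i / 2) := by decide

theorem query_eq_of_knowledge_eq {i s s' : ℕ} (hi : i < 3) (hs : s < 256) (hs' : s' < 256)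
    (h : knowledge i s = knowledge i s') (ha : ambiguous i s = false) :
    query i s = query i s' := by
  have ha' : ambiguous i s' = false := by rwa [ambiguous, ← h]
  have h1 := ambiguous_or_query_eq s hs i hi
  have h2 := ambiguous_or_query_eq s' hs' i hi
  simp only [ha, ha', Bool.false_eq_true, false_or] at h1 h2
  rw [h1, h2, h]

/-! ### Bent functions and their blocks -/

/-- The `i`-th binary digit of `e` as an element of `ZMod 2`. -/
def bit (e i : ℕ) : ZMod 2 := (e.testBit i).toNat

/-- The point `(e, y)` of the cube, where `e` stands for its first three binary digits. -/
def blockPoint {m : ℕ} (e : ℕ) (y : Fin m → ZMod 2) : Fin (m + 3) → ZMod 2 :=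
  Fin.cons (bit e 0)
    (Fin.cons (bit e 1) (Fin.cons (bit e 2) y : Fin (m + 1) → ZMod 2) : Fin (m + 2) → ZMod 2)

/-- The restriction of a function to the points `(e, y)` with fixed `e`. -/
def block {m : ℕ} {M : Type*} (e : ℕ) (F : (Fin (m + 3) → ZMod 2) → M) :
    (Fin m → ZMod 2) → M :=
  fun y => F (blockPoint e y)

theorem LowDeg.block {m r : ℕ} {g : (Fin (m + 3) → ZMod 2) → ZMod 2} (hg : LowDeg (m + 3) r g)
    (e : ℕ) : LowDeg m r (block e g) :=
  ((hg.slice (bit e 0)).slice (bit e 1)).slice (bit e 2)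

theorem exists_blockPoint {m : ℕ} (z : Fin (m + 3) → ZMod 2) :
    ∃ e < 8, ∃ y, blockPoint e y = z := by
  have hbit : ∀ a b c : ZMod 2, ∃ e < 8, bit e 0 = a ∧ bit e 1 = b ∧ bit e 2 = c := by decide
  obtain ⟨e, he, h0, h1, h2⟩ := hbit (z 0) (z 1) (z 2)
  refine ⟨e, he, fun i => z i.succ.succ.succ, ?_⟩
  rw [blockPoint, h0, h1, h2]
  funext i
  refine Fin.cases rfl (fun i => Fin.cases rfl (fun i => Fin.cases rfl (fun i => rfl) i) i) i

theorem cubeFourier_block {m : ℕ} (F : (Fin (m + 3) → ZMod 2) → ℤ) {c : ℕ} (hc : c < 8)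
    (y : Fin m → ZMod 2) :
    8 * cubeFourier (block c F) y = ∑ e ∈ Finset.range 8,
      (1 - 2 * (((character c).testBit e).toNat : ℤ)) * cubeFourier F (blockPoint e y) := by
  have key : ∀ e, cubeFourier F (blockPoint e y) =
      ∑ d ∈ Finset.range 8, sgn (bit d 0 * bit e 0 + bit d 1 * bit e 1 + bit d 2 * bit e 2) *
        cubeFourier (block d F) y := by
    intro e
    simp only [blockPoint, cubeFourier_cons, Finset.sum_range_succ, Finset.sum_range_zero]
    have hb : ∀ d < 8, block d F = slice (bit d 2) (slice (bit d 1) (slice (bit d 0) F)) :=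
      fun d _ => rfl
    simp only [hb 0 (by norm_num), hb 1 (by norm_num), hb 2 (by norm_num), hb 3 (by norm_num),
      hb 4 (by norm_num), hb 5 (by norm_num), hb 6 (by norm_num), hb 7 (by norm_num),
      (by decide : bit 0 0 = 0), (by decide : bit 0 1 = 0), (by decide : bit 0 2 = 0),
      (by decide : bit 1 0 = 1), (by decide : bit 1 1 = 0), (by decide : bit 1 2 = 0),
      (by decide : bit 2 0 = 0), (by decide : bit 2 1 = 1), (by decide : bit 2 2 = 0),
      (by decide : bit 3 0 = 1), (by decide : bit 3 1 = 1), (by decide : bit 3 2 = 0),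
      (by decide : bit 4 0 = 0), (by decide : bit 4 1 = 0), (by decide : bit 4 2 = 1),
      (by decide : bit 5 0 = 1), (by decide : bit 5 1 = 0), (by decide : bit 5 2 = 1),
      (by decide : bit 6 0 = 0), (by decide : bit 6 1 = 1), (by decide : bit 6 2 = 1),
      (by decide : bit 7 0 = 1), (by decide : bit 7 1 = 1), (by decide : bit 7 2 = 1),
      zero_mul, one_mul, zero_add, add_zero, sgn_add, sgn_zero]
    ring
  have horth : ∀ c < 8, ∀ d < 8, ∑ e ∈ Finset.range 8,
      (1 - 2 * (((character c).testBit e).toNat : ℤ)) *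
        sgn (bit d 0 * bit e 0 + bit d 1 * bit e 1 + bit d 2 * bit e 2) =
      if d = c then 8 else 0 := by decide +kernel
  simp only [key, Finset.mul_sum, ← mul_assoc]
  rw [Finset.sum_comm]
  simp only [← Finset.sum_mul]
  rw [Finset.sum_congr rfl fun d hd => by rw [horth c hc d (Finset.mem_range.1 hd)]]
  simp [hc]

/-- The dual of a bent function. -/
def dual {n : ℕ} (f : (Fin n → ZMod 2) → ZMod 2) (y : Fin n → ZMod 2) : ZMod 2 :=
  if walsh f y = 2 ^ (n / 2) then 0 else 1

theorem IsBent.walsh_eq {n : ℕ} {f : (Fin n → ZMod 2) → ZMod 2} (hf : IsBent f)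
    (y : Fin n → ZMod 2) : walsh f y = 2 ^ (n / 2) * sgn (dual f y) := by
  rw [dual]
  split_ifs with h
  · simp [h]
  · simp [(hf y).resolve_left h]

theorem IsBent.walsh_dual {n : ℕ} (hn : n % 2 = 0) {f : (Fin n → ZMod 2) → ZMod 2}
    (hf : IsBent f) (x : Fin n → ZMod 2) : walsh (dual f) x = 2 ^ (n / 2) * sgn (f x) := by
  have h := cubeFourier_cubeFourier (fun x => sgn (f x)) x
  rw [← walsh_eq_cubeFourier, funext hf.walsh_eq, cubeFourier_const_mul,
    show (2 : ℤ) ^ n = 2 ^ (n / 2) * 2 ^ (n / 2) by rw [← pow_add]; congr 1; omega,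
    mul_assoc] at h
  rw [walsh_eq_cubeFourier]
  exact mul_left_cancel₀ (by positivity) h

theorem IsBent.eq_of_dual_eq {n : ℕ} (hn : n % 2 = 0) {f f' : (Fin n → ZMod 2) → ZMod 2}
    (hf : IsBent f) (hf' : IsBent f') (h : dual f = dual f') : f = f' := by
  funext x
  have := hf.walsh_dual hn x
  rw [h, hf'.walsh_dual hn x] at this
  exact (sgn_injective (mul_left_cancel₀ (by positivity) this)).symm

theorem IsBent.lowDeg {n r : ℕ} {f : (Fin n → ZMod 2) → ZMod 2} (hf : IsBent f)
    (hr : n + 2 ≤ n / 2 + r) (hr' : 2 ≤ r) : LowDeg n r f :=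
  lowDeg_of_dvd_walsh (fun y => by rw [hf.walsh_eq]; exact dvd_mul_right _ _) hr hr'

theorem IsBent.lowDeg_dual {n r : ℕ} (hn : n % 2 = 0) {f : (Fin n → ZMod 2) → ZMod 2}
    (hf : IsBent f) (hr : n + 2 ≤ n / 2 + r) (hr' : 2 ≤ r) : LowDeg n r (dual f) :=
  lowDeg_of_dvd_walsh (fun y => by rw [hf.walsh_dual hn]; exact dvd_mul_right _ _) hr hr'

/-- The values of `g` at the eight points `(e, y)`, as an 8-bit pattern. -/
def pattern {m : ℕ} (g : (Fin (m + 3) → ZMod 2) → ZMod 2) (y : Fin m → ZMod 2) : ℕ :=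
  Nat.ofBits fun e : Fin 8 => decide (g (blockPoint e y) = 1)

theorem pattern_lt {m : ℕ} (g : (Fin (m + 3) → ZMod 2) → ZMod 2) (y : Fin m → ZMod 2) :
    pattern g y < 256 :=
  Nat.ofBits_lt_two_pow _

theorem testBit_pattern {m : ℕ} (g : (Fin (m + 3) → ZMod 2) → ZMod 2) (y : Fin m → ZMod 2)
    {e : ℕ} (he : e < 8) : (pattern g y).testBit e = decide (block e g y = 1) :=
  Nat.testBit_ofBits_lt _ _ he

theorem testBit_pattern_toNat {m : ℕ} (g : (Fin (m + 3) → ZMod 2) → ZMod 2)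
    (y : Fin m → ZMod 2) {e : ℕ} (he : e < 8) :
    (((pattern g y).testBit e).toNat : ZMod 2) = block e g y := by
  rw [testBit_pattern g y he]
  generalize block e g y = b
  revert b
  decide

theorem eq_of_pattern_eq {m : ℕ} {g g' : (Fin (m + 3) → ZMod 2) → ZMod 2}
    (h : pattern g = pattern g') : g = g' := by
  funext z
  obtain ⟨e, he, y, rfl⟩ := exists_blockPoint z
  have h1 := testBit_pattern_toNat g y he
  rw [h, testBit_pattern_toNat g' y he] at h1
  exact h1.symm

theorem IsBent.cubeFourier_block {m : ℕ} {f : (Fin (m + 3) → ZMod 2) → ZMod 2} (hf : IsBent f)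
    {c : ℕ} (hc : c < 8) (y : Fin m → ZMod 2) :
    8 * cubeFourier (fun x => sgn (block c f x)) y =
      2 ^ ((m + 3) / 2) * (8 - 2 * (popcount (pattern (dual f) y ^^^ character c) : ℤ)) := by
  have h := _root_.cubeFourier_block (fun x => sgn (f x)) hc y
  rw [← walsh_eq_cubeFourier] at h
  refine h.trans ?_
  have hsign : ∀ b b' : Bool, ∀ a : ZMod 2, b' = decide (a = 1) →
      (1 - 2 * (b.toNat : ℤ)) * sgn a = 1 - 2 * ((b' ^^ b).toNat : ℤ) := by decide
  have (e : ℕ) (he : e ∈ Finset.range 8) :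
      (1 - 2 * (((character c).testBit e).toNat : ℤ)) * walsh f (blockPoint e y) =
        2 ^ ((m + 3) / 2) *
          (1 - 2 * (((pattern (dual f) y ^^^ character c).testBit e).toNat : ℤ)) := by
    rw [hf.walsh_eq, Nat.testBit_xor, mul_left_comm]
    exact congrArg _ (hsign _ _ _ (testBit_pattern (dual f) y (Finset.mem_range.1 he)))
  rw [Finset.sum_congr rfl this, ← Finset.mul_sum, Finset.sum_sub_distrib, ← Finset.mul_sum,
    popcount_eq_sum_testBit]
  simp

theorem IsBent.popcount_eq {m : ℕ} {f f' : (Fin (m + 3) → ZMod 2) → ZMod 2} (hf : IsBent f)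
    (hf' : IsBent f') {c : ℕ} (hc : c < 8) (h : block c f = block c f') (y : Fin m → ZMod 2) :
    popcount (pattern (dual f) y ^^^ character c) =
      popcount (pattern (dual f') y ^^^ character c) := by
  have h1 := hf.cubeFourier_block hc y
  rw [h, hf'.cubeFourier_block hc y] at h1
  have := mul_left_cancel₀ (by positivity) h1
  omega

/-- The pattern of the dual of `f` at `y`, twisted by the `t`-th character. -/
def view {m : ℕ} (t : ℕ) (f : (Fin (m + 3) → ZMod 2) → ZMod 2) (y : Fin m → ZMod 2) : ℕ :=
  pattern (dual f) y ^^^ character t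

theorem view_lt {m t : ℕ} (ht : t < 8) (f : (Fin (m + 3) → ZMod 2) → ZMod 2)
    (y : Fin m → ZMod 2) : view t f y < 256 :=
  Nat.xor_lt_two_pow (n := 8) (pattern_lt _ y) (character_lt t ht)

theorem IsBent.spectrumKey_view_eq {m t : ℕ} (ht : t < 8)
    {f f' : (Fin (m + 3) → ZMod 2) → ZMod 2} (hf : IsBent f) (hf' : IsBent f')
    (h : ∀ i < 4, block ((2 ^ i / 2) ^^^ t) f = block ((2 ^ i / 2) ^^^ t) f')
    (y : Fin m → ZMod 2) : spectrumKey (view t f y) = spectrumKey (view t f' y) := by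
  have key (i : ℕ) (hi : i < 4) : popcount (view t f y ^^^ character (2 ^ i / 2)) =
      popcount (view t f' y ^^^ character (2 ^ i / 2)) := by
    have hc : (2 ^ i / 2) ^^^ t < 8 :=
      Nat.xor_lt_two_pow (n := 3) (by interval_cases i <;> norm_num) ht
    rw [view, view, Nat.xor_assoc, Nat.xor_assoc, ← character_xor i hi t ht]
    exact hf.popcount_eq hf' hc (h i hi) y
  have h0 := key 0 (by norm_num)
  have h1 := key 1 (by norm_num)
  have h2 := key 2 (by norm_num)
  have h3 := key 3 (by norm_num)
  norm_num at h0 h1 h2 h3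
  rw [spectrumKey, spectrumKey, h0, h1, h2, h3]

theorem exists_view_ambiguous_le {m : ℕ} (f : (Fin (m + 3) → ZMod 2) → ZMod 2) :
    ∃ t < 8, 2 * ∑ i ∈ Finset.range 3,
      (Finset.univ.filter fun y : Fin m → ZMod 2 => ambiguous i (view t f y)).card
        ≤ 3 * 2 ^ m := by
  by_contra! h
  have h1 : ∑ _t ∈ Finset.range 8, 3 * 2 ^ m < ∑ t ∈ Finset.range 8, 2 * ∑ i ∈ Finset.range 3,
      (Finset.univ.filter fun y : Fin m → ZMod 2 => ambiguous i (view t f y)).card :=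
    Finset.sum_lt_sum_of_nonempty (by simp) fun t ht => h t (Finset.mem_range.1 ht)
  have h2 : ∑ t ∈ Finset.range 8, ∑ i ∈ Finset.range 3,
      (Finset.univ.filter fun y : Fin m → ZMod 2 => ambiguous i (view t f y)).card =
        ∑ y : Fin m → ZMod 2, ∑ t ∈ Finset.range 8, ∑ i ∈ Finset.range 3,
          (ambiguous i (view t f y)).toNat := by
    have hcard (i t : ℕ) : (Finset.univ.filter fun y : Fin m → ZMod 2 =>
        ambiguous i (view t f y)).card = ∑ y, (ambiguous i (view t f y)).toNat := by
      rw [Finset.card_filter]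
      refine Finset.sum_congr rfl fun y _ => ?_
      cases ambiguous i (view t f y) <;> simp
    simp only [hcard]
    rw [Finset.sum_comm (s := Finset.univ)]
    exact Finset.sum_congr rfl fun t _ => Finset.sum_comm
  have h3 := Finset.sum_le_sum fun y (_ : y ∈ (Finset.univ : Finset (Fin m → ZMod 2))) =>
    sum_ambiguous_le _ (pattern_lt (dual f) y)
  simp only [← Finset.mul_sum, h2] at h1
  simp only [view] at h1
  simp only [Finset.sum_const, Finset.card_range, Finset.card_univ, Fintype.card_fun, ZMod.card,
    Fintype.card_fin, smul_eq_mul] at h1 h3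
  omega

theorem lowDeg_query_view_add {m r t i : ℕ} {f f' : (Fin (m + 3) → ZMod 2) → ZMod 2}
    (hf : LowDeg (m + 3) r (dual f)) (hf' : LowDeg (m + 3) r (dual f')) :
    LowDeg m r fun y =>
      ((query i (view t f y)).toNat : ZMod 2) + (query i (view t f' y)).toNat := by
  have hxor (a b : Bool) : ((a ^^ b).toNat : ZMod 2) = a.toNat + b.toNat := by
    revert a b; decide
  have hcancel (a b c : ZMod 2) : a + c + (b + c) = a + b := by
    revert a b c; decide
  have hbit (e : ℕ) (he : e < 8) : LowDeg m r fun y =>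
      (((view t f y).testBit e).toNat : ZMod 2) + ((view t f' y).testBit e).toNat := by
    simp only [view, Nat.testBit_xor, hxor, testBit_pattern_toNat _ _ he, hcancel]
    exact (hf.block e).add (hf'.block e)
  rcases i with _ | _ | i
  · simp only [query, hxor, add_add_add_comm _ _ (((view t f' _).testBit 1).toNat : ZMod 2)]
    exact (hbit 1 (by norm_num)).add (hbit 2 (by norm_num))
  · exact hbit 0 (by norm_num)
  · simp only [query, hxor, add_add_add_comm _ _ (((view t f' _).testBit 1).toNat : ZMod 2)]
    exact (hbit 1 (by norm_num)).add (hbit 4 (by norm_num))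

/-! ### Counting -/

theorem Finset.card_pow_le_of_card_fiber_pow_le {α β : Type*} [DecidableEq β] {S : Finset α}
    {T : Finset β} {φ : α → β} {K B : ℕ} (hK : K ≠ 0) (hφ : ∀ a ∈ S, φ a ∈ T)
    (h : ∀ b ∈ T, (S.filter fun a => φ a = b).card ^ K ≤ B) : S.card ^ K ≤ B * T.card ^ K := by
  set M := Nat.findGreatest (fun M => M ^ K ≤ B) B
  have hM : M ^ K ≤ B :=
    Nat.findGreatest_spec (P := fun M => M ^ K ≤ B) (Nat.zero_le B) (by simp [hK])
  have hfib : ∀ b ∈ T, (S.filter fun a => φ a = b).card ≤ M := fun b hb =>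
    Nat.le_findGreatest ((Nat.le_self_pow hK _).trans (h b hb)) (h b hb)
  calc S.card ^ K ≤ (M * T.card) ^ K :=
        Nat.pow_le_pow_left (Finset.card_le_mul_card_image_of_maps_to hφ M hfib) K
    _ = M ^ K * T.card ^ K := mul_pow ..
    _ ≤ B * T.card ^ K := Nat.mul_le_mul_right _ hM

/-- What is known about the dual of `f` before query `i` is revealed. -/
def info {m : ℕ} (t i : ℕ) (f : (Fin (m + 3) → ZMod 2) → ZMod 2) (y : Fin m → ZMod 2) : ℕ :=
  knowledge i (view t f y)

/-- The points at which query `i` is not determined by `info t i f`. -/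
def ambiguousSet {m : ℕ} (t i : ℕ) (f : (Fin (m + 3) → ZMod 2) → ZMod 2) :
    Finset (Fin m → ZMod 2) :=
  Finset.univ.filter fun y => ambiguous i (view t f y)

theorem info_div_two {m t i : ℕ} (f : (Fin (m + 3) → ZMod 2) → ZMod 2) (y : Fin m → ZMod 2) :
    info t (i + 1) f y / 2 = info t i f y := by
  have := Bool.toNat_lt (query i (view t f y))
  simp only [info, knowledge]
  omega

theorem info_succ_cast {m t i : ℕ} (f : (Fin (m + 3) → ZMod 2) → ZMod 2) (y : Fin m → ZMod 2) :
    (info t (i + 1) f y : ZMod 2) = (query i (view t f y)).toNat := by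
  simp only [info, knowledge]
  push_cast
  rw [show (2 : ZMod 2) = 0 from rfl, zero_mul, zero_add]

section

variable {m r t : ℕ} {S : Finset ((Fin (m + 3) → ZMod 2) → ZMod 2)}

open Classical in
theorem card_image_info_zero_pow_le (ht : t < 8) (hr : m + 5 ≤ (m + 3) / 2 + r) (hr' : 2 ≤ r)
    (hS : ∀ f ∈ S, IsBent f) :
    (S.image (info t 0)).card ^ 2 ^ m ≤ 2 ^ (4 * (numMonomials m r * 2 ^ m)) := by
  set β : ((Fin (m + 3) → ZMod 2) → ZMod 2) → Fin 4 → (Fin m → ZMod 2) → ZMod 2 :=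
    fun f i => block ((2 ^ (i : ℕ) / 2) ^^^ t) f
  have h1 : (S.image (info t 0)).card ≤ (S.image β).card := by
    have hfac : ∀ f ∈ S, ∀ f' ∈ S, β f = β f' → info t 0 f = info t 0 f' := by
      intro f hf f' hf' h
      funext y
      exact (hS f hf).spectrumKey_view_eq ht (hS f' hf') (fun i hi => congrFun h ⟨i, hi⟩) y
    refine Finset.card_le_card_of_surjOn (fun b => info t 0 (Function.invFunOn β S b)) ?_
    intro k hk
    simp only [Finset.coe_image, Set.mem_image, Finset.mem_coe] at hk ⊢
    obtain ⟨f, hf, rfl⟩ := hk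
    have hex : ∃ g ∈ (S : Set _), β g = β f := ⟨f, hf, rfl⟩
    exact ⟨β f, ⟨f, hf, rfl⟩, hfac _ (Function.invFunOn_mem hex) f hf
      (Function.invFunOn_eq hex)⟩
  have h2 : (S.image β).card ≤ (lowDegOn m r Finset.univ).card ^ 4 := by
    have hsub : S.image β ⊆ Fintype.piFinset fun _ => lowDegOn m r Finset.univ := by
      intro b hb
      obtain ⟨f, hf, rfl⟩ := Finset.mem_image.1 hb
      rw [Fintype.mem_piFinset]
      exact fun i => mem_lowDegOn.2 ⟨((hS f hf).lowDeg hr hr').block _, by simp⟩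
    simpa using Finset.card_le_card hsub
  calc (S.image (info t 0)).card ^ 2 ^ m
      ≤ ((lowDegOn m r Finset.univ).card ^ 4) ^ 2 ^ m := Nat.pow_le_pow_left (h1.trans h2) _
    _ = ((lowDegOn m r Finset.univ).card ^ 2 ^ m) ^ 4 := by rw [← pow_mul, ← pow_mul, mul_comm]
    _ ≤ (2 ^ (numMonomials m r * 2 ^ m)) ^ 4 := by
        refine Nat.pow_le_pow_left ((card_lowDegOn_pow_le m r _).trans_eq ?_) 4
        simp [ZMod.card]
    _ = _ := by rw [← pow_mul, mul_comm 4]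

open Classical in
theorem card_image_info_succ_pow_le {i a : ℕ} (ht : t < 8) (hi : i < 3)
    (hS : ∀ f ∈ S, LowDeg (m + 3) r (dual f)) (ha : ∀ f ∈ S, (ambiguousSet t i f).card = a) :
    (S.image (info t (i + 1))).card ^ 2 ^ m ≤
      2 ^ (numMonomials m r * a) * (S.image (info t i)).card ^ 2 ^ m := by
  refine Finset.card_pow_le_of_card_fiber_pow_le (φ := fun k y => k y / 2) (by positivity)
    (fun k hk => ?_) fun κ hκ => ?_
  · obtain ⟨f, hf, rfl⟩ := Finset.mem_image.1 hk
    simp only [info_div_two]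
    exact Finset.mem_image_of_mem _ hf
  obtain ⟨f₀, hf₀, rfl⟩ := Finset.mem_image.1 hκ
  have hU : ∀ f, info t i f = info t i f₀ → ambiguousSet t i f = ambiguousSet t i f₀ := by
    intro f h
    ext y
    have := congrFun h y
    simp only [info] at this
    simp only [ambiguousSet, Finset.mem_filter_univ]
    simp only [ambiguous, this]
  rw [← ha f₀ hf₀]
  refine le_trans (Nat.pow_le_pow_left ?_ _) (card_lowDegOn_pow_le m r (ambiguousSet t i f₀))
  have hinj : Set.InjOn (fun (k : (Fin m → ZMod 2) → ℕ) y => (k y : ZMod 2))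
      ((S.image (info t (i + 1))).filter fun k => (fun y => k y / 2) = info t i f₀ :
        Set ((Fin m → ZMod 2) → ℕ)) := by
    intro k hk k' hk' h
    simp only [Finset.coe_filter, Set.mem_ofPred_eq] at hk hk'
    funext y
    have h1 := congrFun (hk.2.trans hk'.2.symm) y
    have h2 := (ZMod.natCast_eq_natCast_iff' _ _ 2).1 (congrFun h y)
    omega
  rw [← Finset.card_image_of_injOn hinj]
  refine Finset.card_le_card_of_add_mem ?_
  simp only [Finset.mem_image, Finset.mem_filter, mem_lowDegOn, forall_exists_index, and_imp]
  rintro _ _ f hf rfl hfi rfl _ _ f' hf' rfl hfi' rfl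
  simp only [info_div_two] at hfi hfi'
  simp only [info_succ_cast]
  refine ⟨lowDeg_query_view_add (hS f hf) (hS f' hf'), fun y hy => ?_⟩
  rw [← hU f hfi] at hy
  have hq : query i (view t f y) = query i (view t f' y) :=
    query_eq_of_knowledge_eq hi (view_lt ht f y) (view_lt ht f' y)
      (congrFun (hfi.trans hfi'.symm) y) (by simpa [ambiguousSet] using hy)
  rw [Pi.add_apply, hq, zmod_two_add_self]

open Classical in
theorem card_image_info_three (ht : t < 8) (hm : (m + 3) % 2 = 0) (hS : ∀ f ∈ S, IsBent f) :
    (S.image (info t 3)).card = S.card := by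
  refine Finset.card_image_of_injOn fun f hf f' hf' h => ?_
  refine (hS f hf).eq_of_dual_eq hm (hS f' hf') (eq_of_pattern_eq (funext fun y => ?_))
  exact Nat.xor_left_injective
    (injOn_knowledge_three (view_lt ht f y) (view_lt ht f' y) (congrFun h y))

theorem card_sq_le_of_ambiguousSet_card {a : ℕ → ℕ} (ht : t < 8) (hm : (m + 3) % 2 = 0)
    (hr : m + 5 ≤ (m + 3) / 2 + r) (hr' : 2 ≤ r) (hS : ∀ f ∈ S, IsBent f)
    (ha : ∀ i < 3, ∀ f ∈ S, (ambiguousSet t i f).card = a i)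
    (hsum : 2 * ∑ i ∈ Finset.range 3, a i ≤ 3 * 2 ^ m) :
    S.card ^ 2 ≤ 2 ^ (11 * numMonomials m r) := by
  classical
  have hd : ∀ f ∈ S, LowDeg (m + 3) r (dual f) := fun f hf =>
    (hS f hf).lowDeg_dual hm (by omega) hr'
  have h0 := card_image_info_zero_pow_le (r := r) ht hr hr' hS
  have h1 := card_image_info_succ_pow_le ht (by norm_num) hd (ha 0 (by norm_num))
  have h2 := card_image_info_succ_pow_le ht (by norm_num) hd (ha 1 (by norm_num))
  have h3 := card_image_info_succ_pow_le ht (by norm_num) hd (ha 2 (by norm_num))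
  rw [card_image_info_three ht hm hS] at h3
  set D := numMonomials m r
  have key : S.card ^ 2 ^ m ≤ 2 ^ (D * a 2 + (D * a 1 + (D * a 0 + 4 * (D * 2 ^ m)))) := by
    simp only [pow_add]
    exact h3.trans (Nat.mul_le_mul_left _ (h2.trans (Nat.mul_le_mul_left _
      (h1.trans (Nat.mul_le_mul_left _ h0)))))
  have : (S.card ^ 2) ^ 2 ^ m ≤ (2 ^ (11 * D)) ^ 2 ^ m := by
    rw [pow_right_comm, ← pow_mul 2 (11 * D)]
    refine (Nat.pow_le_pow_left key 2).trans ?_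
    rw [← pow_mul]
    refine Nat.pow_le_pow_right (by norm_num) ?_
    simp only [Finset.sum_range_succ, Finset.sum_range_zero] at hsum
    nlinarith [Nat.mul_le_mul_left D hsum]
  exact (Nat.pow_le_pow_iff_left (by positivity)).1 this

end

theorem natCard_isBent_sq_le {m r : ℕ} (hm : (m + 3) % 2 = 0) (hr : m + 5 ≤ (m + 3) / 2 + r)
    (hr' : 2 ≤ r) : Nat.card {f : (Fin (m + 3) → ZMod 2) → ZMod 2 // IsBent f} ^ 2 ≤
      2 ^ (11 * numMonomials m r) * (8 * (2 ^ m + 1) ^ 3) ^ 2 := by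
  classical
  choose t ht hsum using fun f : (Fin (m + 3) → ZMod 2) → ZMod 2 => exists_view_ambiguous_le f
  have hcard (i f) : (ambiguousSet (m := m) (t f) i f).card < 2 ^ m + 1 := by
    refine Nat.lt_succ_of_le ((Finset.card_le_univ _).trans_eq ?_)
    simp [ZMod.card]
  have := Finset.card_pow_le_of_card_fiber_pow_le (K := 2) (B := 2 ^ (11 * numMonomials m r))
    (S := Finset.univ.filter fun f : (Fin (m + 3) → ZMod 2) → ZMod 2 => IsBent f)
    (T := (Finset.univ : Finset (Fin 8 × (Fin 3 → Fin (2 ^ m + 1)))))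
    (φ := fun f => (⟨t f, ht f⟩, fun i => ⟨_, hcard i f⟩)) two_ne_zero (by simp) ?_
  · simpa [Nat.card_eq_fintype_card, Fintype.card_subtype] using this
  rintro ⟨t₀, a⟩ -
  rcases Finset.eq_empty_or_nonempty (((Finset.univ.filter fun f :
    (Fin (m + 3) → ZMod 2) → ZMod 2 => IsBent f)).filter fun f =>
      ((⟨t f, ht f⟩, fun i => ⟨_, hcard i f⟩) : Fin 8 × (Fin 3 → Fin (2 ^ m + 1))) = (t₀, a))
    with h | ⟨f₀, hf₀⟩
  · rw [h]
    simp
  simp only [Finset.mem_filter, Finset.mem_univ, true_and, Prod.mk.injEq] at hf₀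
  have hval {f} (h1 : (⟨t f, ht f⟩ : Fin 8) = t₀)
      (h2 : (fun i : Fin 3 => (⟨_, hcard i f⟩ : Fin (2 ^ m + 1))) = a) (i : ℕ) (hi : i < 3) :
      (ambiguousSet (m := m) t₀ i f).card = (ambiguousSet (m := m) t₀ i f₀).card := by
    have e := congrFun (h2.trans hf₀.2.2.symm) ⟨i, hi⟩
    rw [Fin.mk.injEq] at e
    have e1 := congrArg Fin.val h1
    have e2 := congrArg Fin.val hf₀.2.1
    simp only at e e1 e2
    rwa [e1, e2] at e
  refine card_sq_le_of_ambiguousSet_card (t := t₀) (a := fun i => (ambiguousSet t₀ i f₀).card)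
    t₀.2 hm hr hr' (fun f hf => ?_) (fun i hi f hf => ?_) ?_
  · exact (Finset.mem_filter.1 (Finset.mem_filter.1 hf).1).2
  · have := (Finset.mem_filter.1 hf).2
    rw [Prod.mk.injEq] at this
    exact hval this.1 this.2 i hi
  · have := hsum f₀
    rw [show t f₀ = t₀ from congrArg Fin.val hf₀.2.1] at this
    exact this

/-! ### Asymptotics -/

theorem centralBinom_sq_mul_le (j : ℕ) : j.centralBinom ^ 2 * (2 * j + 1) ≤ 16 ^ j := by
  induction j with
  | zero => simp
  | succ j ih =>
    have h := Nat.succ_mul_centralBinom_succ j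
    have h1 : (j + 1) ^ 2 * ((j + 1).centralBinom ^ 2 * (2 * (j + 1) + 1)) ≤
        (j + 1) ^ 2 * 16 ^ (j + 1) :=
      calc (j + 1) ^ 2 * ((j + 1).centralBinom ^ 2 * (2 * (j + 1) + 1))
          = (2 * (2 * j + 1) * j.centralBinom) ^ 2 * (2 * j + 3) := by rw [← h]; ring
        _ = j.centralBinom ^ 2 * (2 * j + 1) * (4 * (2 * j + 1) * (2 * j + 3)) := by ring
        _ ≤ 16 ^ j * (16 * (j + 1) ^ 2) := Nat.mul_le_mul ih (by nlinarith)
        _ = _ := by ring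
    exact Nat.le_of_mul_le_mul_left h1 (by positivity)

theorem numMonomials_le (k : ℕ) :
    numMonomials (2 * k + 3) (k + 5) ≤ 4 ^ (k + 1) + 3 * (k + 2).centralBinom := by
  have h (i : ℕ) : (2 * k + 3).choose i ≤ (k + 2).centralBinom :=
    (Nat.choose_le_choose i (by omega)).trans (Nat.choose_le_centralBinom i (k + 2))
  have h0 : ∑ i ∈ Finset.range (k + 2), (2 * k + 3).choose i = 4 ^ (k + 1) :=
    Nat.sum_range_choose_halfway (k + 1)
  simp only [numMonomials, Finset.sum_range_succ _ (k + 4), Finset.sum_range_succ _ (k + 3),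
    Finset.sum_range_succ _ (k + 2), h0]
  linarith [h (k + 2), h (k + 3), h (k + 4)]

theorem logNumBent_le_numMonomials (k : ℕ) : logNumBent (2 * k + 6) ≤
    11 / 2 * numMonomials (2 * k + 3) (k + 5) + 3 * (2 * k + 5) := by
  have h := natCard_isBent_sq_le (m := 2 * k + 3) (r := k + 5) (by omega) (by omega) (by omega)
  rw [logNumBent]
  set N := Nat.card {f : (Fin (2 * k + 3 + 3) → ZMod 2) → ZMod 2 // IsBent f}
  set D := numMonomials (2 * k + 3) (k + 5)
  rcases Nat.eq_zero_or_pos N with h0 | h0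
  · change Real.logb 2 (N : ℝ) ≤ _
    rw [h0]
    simp
    positivity
  have h8 : 8 * (2 ^ (2 * k + 3) + 1) ^ 3 ≤ 2 ^ (3 * (2 * k + 5)) := by
    rw [show 3 * (2 * k + 5) = 3 + (2 * k + 4) * 3 by ring, pow_add 2 3, pow_mul 2 (2 * k + 4)]
    refine Nat.mul_le_mul_left _ (Nat.pow_le_pow_left ?_ 3)
    rw [show 2 * k + 4 = 2 * k + 3 + 1 by ring, pow_succ 2 (2 * k + 3)]
    have := Nat.one_le_two_pow (n := 2 * k + 3)
    omega
  have h1 : N ^ 2 ≤ 2 ^ (11 * D + 3 * (2 * k + 5) * 2) := by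
    rw [pow_add, pow_mul 2 _ 2]
    exact h.trans (Nat.mul_le_mul_left _ (Nat.pow_le_pow_left h8 2))
  have h2 := Real.logb_le_logb_of_le (b := 2) (by norm_num) (by positivity)
    (show (N : ℝ) ^ 2 ≤ 2 ^ (11 * D + 3 * (2 * k + 5) * 2) by exact_mod_cast h1)
  rw [Real.logb_pow, Real.logb_pow, Real.logb_self_eq_one (by norm_num)] at h2
  push_cast at h2
  change Real.logb 2 (N : ℝ) ≤ _
  linarith

/-- Asymptotic upper bound `𝒩(n) ≤ (11/32)·2ⁿ·(1 + o(1))` on the number of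
`n`-variable bent functions. -/
theorem logNumBent_le :
    ∀ ε > (0 : ℝ), ∃ N : ℕ, ∀ n ≥ N, n % 2 = 0 →
      logNumBent n ≤ (11 / 32 + ε) * 2 ^ n := by
  intro ε hε
  obtain ⟨A, hA⟩ := exists_nat_gt (10000 / ε ^ 2)
  refine ⟨2 * A + 6, fun n hn hpar => ?_⟩
  obtain ⟨k, rfl⟩ : ∃ k, n = 2 * k + 6 := ⟨n / 2 - 3, by omega⟩
  have hk : (A : ℝ) ≤ k := by exact_mod_cast (by omega : A ≤ k)
  have hε2 : 10000 ≤ ε ^ 2 * k := by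
    rw [div_lt_iff₀ (by positivity)] at hA
    nlinarith [sq_nonneg ε]
  set c := ((k + 2).centralBinom : ℝ) with hc
  have hc0 : 0 ≤ c := by positivity
  have hD : (numMonomials (2 * k + 3) (k + 5) : ℝ) ≤ 4 ^ (k + 1) + 3 * c := by
    rw [hc]
    exact_mod_cast numMonomials_le k
  have hcb : c ^ 2 * (2 * (k + 2) + 1) ≤ (4 ^ (k + 2)) ^ 2 := by
    have := centralBinom_sq_mul_le (k + 2)
    rw [← pow_mul, mul_comm (k + 2) 2, pow_mul]
    rw [hc]
    norm_num
    exact_mod_cast this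
  have hpow : (2 : ℝ) ^ (2 * k + 6) = 4 * 4 ^ (k + 2) := by
    rw [show 2 * k + 6 = 2 * (k + 3) by ring, pow_mul]
    norm_num
    ring
  set X : ℝ := 4 ^ (k + 2) with hX
  have hX4 : (4 : ℝ) ^ (k + 1) = X / 4 := by rw [hX, pow_succ 4 (k + 1)]; ring
  have hX0 : 0 < X := by positivity
  have hcX : 10 * c ≤ ε * X := by
    refine le_of_sq_le_sq ?_ (by positivity)
    have h1 := mul_le_mul_of_nonneg_left hcb (sq_nonneg ε)
    have h2 := mul_le_mul_of_nonneg_right hε2 (sq_nonneg c)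
    nlinarith [mul_nonneg (sq_nonneg ε) (sq_nonneg c)]
  have hkc : (2 * (k + 2) : ℝ) ≤ c := by
    have := Nat.choose_le_centralBinom 1 (k + 2)
    rw [Nat.choose_one_right] at this
    rw [hc]
    exact_mod_cast this
  have := logNumBent_le_numMonomials k
  rw [hpow]
  nlinarith
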